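/- Let A, B, C be n₁×n₁ real matrices and D an n₂×n₂ real matrix, and let M be the (2n₁+n₂)×(2n₁+n₂) block matrix [[A, B, J_{n₁×n₂}],[B, C, O_{n₁×n₂}],[J_{n₂×n₁}, O_{n₂×n₁}, D]], where J denotes an all-ones block and O a zero block. Then for every real x such that xI_{n₂} − D is invertible, the Schur complement of the block xI_{n₂} − D in the characteristic matrix xI_{2n₁+n₂} − M equals the 2n₁×2n₁ block matrix [[xI_{n₁} − A − Γ_D(x)·J_{n₁}, −B],[−B, xI_{n₁} − C]], where J_{n₁} is the n₁×n₁ all-ones matrix. -/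

import Mathlib

open Matrix Finset

/-- The coronal `Γ_M(x)`: the sum of the entries of `(x I - M)⁻¹`. -/
noncomputable def coronal {n : ℕ} (M : Matrix (Fin n) (Fin n) ℝ) (x : ℝ) : ℝ :=
  ∑ i, ∑ j, (x • (1 : Matrix (Fin n) (Fin n) ℝ) - M)⁻¹ i j

/-- The Schur complement of the block `x I - D` in the characteristic matrix `x I - M` of the
block matrix `M = [[A, B, J],[B, C, O],[J, O, D]]` is
`[[x I - A - Γ_D(x) J, -B],[-B, x I - C]]`. -/
theorem schur_complement_of_characteristic_matrix
    {n₁ n₂ : ℕ} (A B C : Matrix (Fin n₁) (Fin n₁) ℝ) (D : Matrix (Fin n₂) (Fin n₂) ℝ)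
    (M : Matrix ((Fin n₁ ⊕ Fin n₁) ⊕ Fin n₂) ((Fin n₁ ⊕ Fin n₁) ⊕ Fin n₂) ℝ)
    (hM : M = Matrix.fromBlocks
      (Matrix.fromBlocks A B B C)
      (Matrix.of fun i _ => Sum.elim (fun _ => (1 : ℝ)) (fun _ => 0) i)
      (Matrix.of fun _ j => Sum.elim (fun _ => (1 : ℝ)) (fun _ => 0) j)
      D)
    (x : ℝ)
    (hD : IsUnit (x • (1 : Matrix (Fin n₂) (Fin n₂) ℝ) - D)) :
    (x • (1 : Matrix ((Fin n₁ ⊕ Fin n₁) ⊕ Fin n₂) ((Fin n₁ ⊕ Fin n₁) ⊕ Fin n₂) ℝ)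
        - M).toBlocks₁₁
      - (x • 1 - M).toBlocks₁₂ * ((x • 1 - M).toBlocks₂₂)⁻¹ * (x • 1 - M).toBlocks₂₁
      = Matrix.fromBlocks
          (x • 1 - A - coronal D x • Matrix.of fun _ _ => (1 : ℝ)) (-B)
          (-B) (x • (1 : Matrix (Fin n₁) (Fin n₁) ℝ) - C) := by
  have h22 : (x • (1 : Matrix ((Fin n₁ ⊕ Fin n₁) ⊕ Fin n₂) ((Fin n₁ ⊕ Fin n₁) ⊕ Fin n₂) ℝ)
      - M).toBlocks₂₂ = x • (1 : Matrix (Fin n₂) (Fin n₂) ℝ) - D := by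
    subst hM
    ext i j
    simp [Matrix.toBlocks₂₂, Matrix.one_apply]
  rw [h22]
  subst hM
  unfold coronal
  generalize (x • (1 : Matrix (Fin n₂) (Fin n₂) ℝ) - D)⁻¹ = N
  ext i j
  rcases i with i | i <;> rcases j with j | j
  · simp [Matrix.toBlocks₁₁, Matrix.toBlocks₁₂, Matrix.toBlocks₂₁, Matrix.mul_apply,
      Matrix.one_apply]
    exact Finset.sum_comm
  all_goals simp [Matrix.toBlocks₁₁, Matrix.toBlocks₁₂, Matrix.toBlocks₂₁, Matrix.mul_apply,
      Matrix.one_apply]
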